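/- arXiv:1512.09340 — 2 statements merged into one kernel-verified Lean document; each statement's English description precedes it below -/
import Mathlib

section
/- Let T be an invertible conservative ergodic nonsingular transformation of a nonatomic σ-finite standard Borel measure space (X,μ). If T is ergodic with isometric coefficients, then T is W-measurably sensitive. -/
open MeasureTheory Filter Set
open scoped ENNReal

/-- `d` is a metric on `X` (as a two-variable real function). -/
def IsMetricFun {X : Type*} (d : X → X → ℝ) : Prop :=
  (∀ x, d x x = 0) ∧ (∀ x y, d x y = 0 → x = y) ∧ (∀ x y, d x y = d y x) ∧
    (∀ x y z, d x z ≤ d x y + d y z)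

/-- `d` is a `μ`-compatible metric: it is a metric, measurable on `X × X`, and almost
every point has all of its open balls of positive measure. -/
def MuCompatible {X : Type*} [MeasurableSpace X] (μ : Measure X) (d : X → X → ℝ) : Prop :=
  IsMetricFun d ∧ Measurable (fun p : X × X => d p.1 p.2) ∧
    ∀ᵐ x ∂μ, ∀ ε : ℝ, 0 < ε → 0 < μ {y | d x y < ε}

/-- `T` is W-measurably sensitive with respect to `μ`. -/
def WMeasurablySensitive {X : Type*} [MeasurableSpace X] (μ : Measure X) (T : X → X) :
    Prop :=
  ∀ d : X → X → ℝ, MuCompatible μ d →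
    ∃ δ : ℝ, 0 < δ ∧ ∀ᵐ x ∂μ, ∀ᵐ y ∂μ,
      (δ : EReal) <
        Filter.limsup (fun n : ℕ => ((d (T^[n] x) (T^[n] y) : ℝ) : EReal)) Filter.atTop

/-- `T` is ergodic with isometric coefficients: every Borel map into a separable metric
space intertwining `T` with a surjective isometry is almost everywhere constant. -/
def EIC {X : Type*} [MeasurableSpace X] (μ : Measure X) (T : X → X) : Prop :=
  ∀ (Z : Type) [MetricSpace Z] [TopologicalSpace.SeparableSpace Z]
    [MeasurableSpace Z] [BorelSpace Z] (S : Z ≃ᵢ Z) (φ : X → Z),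
    Measurable φ → (∀ᵐ x ∂μ, φ (T x) = S (φ x)) → ∃ z : Z, ∀ᵐ x ∂μ, φ x = z

/-- `R` is conservative with respect to `ν`. -/
def IsConservative {Y : Type*} [MeasurableSpace Y] (ν : Measure Y) (R : Y → Y) : Prop :=
  ∀ A : Set Y, MeasurableSet A → 0 < ν A → ∃ n : ℕ, 1 ≤ n ∧ 0 < ν (A ∩ R^[n] ⁻¹' A)

/-- `R` is ergodic with respect to `ν`: invariant sets are null or conull. -/
def IsErgodicT {Y : Type*} [MeasurableSpace Y] (ν : Measure Y) (R : Y → Y) : Prop :=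
  ∀ A : Set Y, MeasurableSet A → R ⁻¹' A = A → ν A = 0 ∨ ν Aᶜ = 0

/-- A separable pseudometric space with measurable balls has measurable open sets. -/
theorem opensMeasurableSpace_of_measurableSet_ball {Y : Type*} [PseudoMetricSpace Y]
    [SecondCountableTopology Y] [MeasurableSpace Y]
    (h : ∀ (x : Y) (r : ℝ), MeasurableSet (Metric.ball x r)) : OpensMeasurableSpace Y := by
  refine ⟨MeasurableSpace.generateFrom_le fun U (hU : IsOpen U) => ?_⟩
  choose r hr hrU using fun x : U => Metric.isOpen_iff.1 hU x x.2
  obtain ⟨t, ht, htU⟩ := TopologicalSpace.isOpen_iUnion_countable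
    (fun x : U => Metric.ball (x : Y) (r x)) fun _ => Metric.isOpen_ball
  have hU' : U = ⋃ x ∈ t, Metric.ball (x : Y) (r x) := by
    rw [htU]
    exact Subset.antisymm
      (fun x hx => mem_iUnion.2 ⟨⟨x, hx⟩, Metric.mem_ball_self (hr ⟨x, hx⟩)⟩)
      (iUnion_subset hrU)
  rw [hU']
  exact MeasurableSet.biUnion ht fun x _ => h _ _

/-- The space `Z` in the definition of `EIC` may live in any universe. -/
theorem EIC.exists_ae_eq {X : Type*} [MeasurableSpace X] {μ : Measure X} {T : X → X}
    (h : EIC μ T) {Z : Type*} [MetricSpace Z] [TopologicalSpace.SeparableSpace Z]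
    [MeasurableSpace Z] [BorelSpace Z] (S : Z ≃ᵢ Z) {φ : X → Z} (hφ : Measurable φ)
    (hS : ∀ᵐ x ∂μ, φ (T x) = S (φ x)) : ∃ z : Z, ∀ᵐ x ∂μ, φ x = z := by
  let e := (kuratowskiEmbedding.isometry Z).isometryEquivOnRange
  have : TopologicalSpace.SeparableSpace (range (kuratowskiEmbedding Z)) :=
    e.surjective.denseRange.separableSpace e.continuous
  let : MeasurableSpace (range (kuratowskiEmbedding Z)) := borel _
  have : BorelSpace (range (kuratowskiEmbedding Z)) := ⟨rfl⟩
  obtain ⟨z, hz⟩ := h _ ((e.symm.trans S).trans e) (e ∘ φ) (e.continuous.measurable.comp hφ)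
    (hS.mono fun x hx => by simp [hx])
  exact ⟨e.symm z, hz.mono fun x hx => by simp [← hx]⟩

/-- Points of `s` whose `D`-balls have positive measure are `D`-separable. -/
theorem exists_countable_dense_of_measure_ball_pos {X : Type*} [MeasurableSpace X]
    {μ : Measure X} [SFinite μ] {D : X → X → ℝ} (hcomm : ∀ x y, D x y = D y x)
    (htri : ∀ x y z, D x z ≤ D x y + D y z) (hmeas : ∀ x, Measurable (D x)) {s : Set X}
    (hpos : ∀ x ∈ s, ∀ ε : ℝ, 0 < ε → 0 < μ {y | D x y < ε}) {ε : ℝ} (hε : 0 < ε) :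
    ∃ t ⊆ s, t.Countable ∧ ∀ x ∈ s, ∃ y ∈ t, D x y < ε := by
  obtain ⟨t, ht⟩ := zorn_subset {t : Set X | t ⊆ s ∧ t.Pairwise fun x y => ε ≤ D x y} (by
    intro c hc hchain
    refine ⟨⋃₀ c, ⟨sUnion_subset fun t ht => (hc ht).1, ?_⟩, fun t ht => subset_sUnion_of_mem ht⟩
    exact (pairwise_sUnion hchain.directedOn).2 fun t ht => (hc ht).2)
  refine ⟨t, ht.prop.1, ?_, fun x hx => ?_⟩
  · have hcount := Measure.countable_meas_pos_of_disjoint_iUnion (μ := μ)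
      (As := fun x : t => {y | D x y < ε / 2})
      (fun x => measurableSet_lt (hmeas x) measurable_const) (by
        intro x y hxy
        refine Set.disjoint_left.2 fun z hxz hyz => ?_
        have h1 := ht.prop.2 x.2 y.2 (Subtype.coe_ne_coe.2 hxy)
        have h2 := htri x z y
        rw [hcomm z y] at h2
        simp only [mem_ofPred_eq] at hxz hyz
        linarith)
    have huniv : {x : t | 0 < μ {y | D x y < ε / 2}} = univ :=
      eq_univ_of_forall fun x => hpos x (ht.prop.1 x.2) _ (half_pos hε)
    rw [huniv, countable_univ_iff] at hcount
    exact hcount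
  · by_contra! hfar
    have hxt : x ∈ t := by
      refine ht.le_of_ge (y := insert x t) ⟨insert_subset hx ht.prop.1, ?_⟩
        (subset_insert x t) (mem_insert x t)
      refine ht.prop.2.insert fun y hy _ => ⟨hfar y hy, ?_⟩
      rw [hcomm]
      exact hfar y hy
    have h1 := hfar x hxt
    obtain ⟨y, hy⟩ := nonempty_of_measure_ne_zero (hpos x hx (ε / 2) (half_pos hε)).ne'
    have h2 := htri x y x
    rw [hcomm y x] at h2
    simp only [mem_ofPred_eq] at hy
    linarith

/-- Under `EIC`, an invariant measurable pseudometric whose balls have positive measure is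
almost everywhere degenerate. -/
theorem EIC.exists_ae_eq_zero {X : Type*} [MeasurableSpace X] {μ : Measure X} [SFinite μ]
    [NeZero μ] {T : X ≃ᵐ X} (h : EIC μ T) {D : X → X → ℝ} (hself : ∀ x, D x x = 0)
    (hcomm : ∀ x y, D x y = D y x) (htri : ∀ x y z, D x z ≤ D x y + D y z)
    (hmeas : ∀ x, Measurable (D x)) (hinv : ∀ x y, D (T x) (T y) = D x y) {s : Set X}
    (hs : MeasurableSet s) (hTs : ∀ x, T x ∈ s ↔ x ∈ s) (hsμ : ∀ᵐ x ∂μ, x ∈ s)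
    (hpos : ∀ x ∈ s, ∀ ε : ℝ, 0 < ε → 0 < μ {y | D x y < ε}) :
    ∃ z, ∀ᵐ x ∂μ, D z x = 0 := by
  classical
  let : PseudoMetricSpace s :=
    { dist := fun x y => D x y
      dist_self := fun x => hself x
      dist_comm := fun x y => hcomm x y
      dist_triangle := fun x y z => htri x y z }
  have hdist : ∀ x y : s, dist x y = D x y := fun _ _ => rfl
  have : SecondCountableTopology s := by
    refine Metric.secondCountable_of_almost_dense_set fun ε hε => ?_
    obtain ⟨t, hts, htc, ht⟩ :=
      exists_countable_dense_of_measure_ball_pos hcomm htri hmeas hpos hε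
    refine ⟨(↑) ⁻¹' t, htc.preimage Subtype.val_injective, fun x => ?_⟩
    obtain ⟨y, hy, hxy⟩ := ht x x.2
    exact ⟨⟨y, hts hy⟩, hy, hxy.le⟩
  have : OpensMeasurableSpace s := opensMeasurableSpace_of_measurableSet_ball fun x r => by
    have hball : Metric.ball x r = (↑) ⁻¹' {y | D x y < r} := by
      ext y
      simp only [Metric.mem_ball', mem_preimage, mem_ofPred_eq, hdist]
    rw [hball]
    exact measurable_subtype_coe (measurableSet_lt (hmeas x) measurable_const)
  let : MeasurableSpace (SeparationQuotient s) := borel _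
  have : BorelSpace (SeparationQuotient s) := ⟨rfl⟩
  let f : s ≃ s := T.toEquiv.subtypeEquiv fun x => (hTs x).symm
  have hf : Isometry f := Isometry.of_dist_eq fun x y => hinv x y
  have hf' : Isometry f.symm := hf.right_inv f.apply_symm_apply
  let S : SeparationQuotient s ≃ᵢ SeparationQuotient s := IsometryEquiv.mk'
    (SeparationQuotient.lift (SeparationQuotient.mk ∘ f) fun x y hxy =>
      SeparationQuotient.mk_eq_mk.2 (hxy.map hf.continuous))
    (SeparationQuotient.lift (SeparationQuotient.mk ∘ f.symm) fun x y hxy =>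
      SeparationQuotient.mk_eq_mk.2 (hxy.map hf'.continuous))
    (SeparationQuotient.surjective_mk.forall.2 fun x => by simp)
    (Isometry.of_dist_eq (SeparationQuotient.surjective_mk.forall₂.2 fun x y =>
      hf.dist_eq x y))
  have : TopologicalSpace.SeparableSpace (SeparationQuotient s) :=
    SeparationQuotient.surjective_mk.denseRange.separableSpace SeparationQuotient.continuous_mk
  obtain ⟨a, ha⟩ := hsμ.exists
  let φ : X → SeparationQuotient s := fun x =>
    if hx : x ∈ s then SeparationQuotient.mk ⟨x, hx⟩ else SeparationQuotient.mk ⟨a, ha⟩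
  have hφ : Measurable φ :=
    Measurable.dite SeparationQuotient.continuous_mk.measurable measurable_const hs
  obtain ⟨w, hw⟩ := h.exists_ae_eq S hφ (hsμ.mono fun x hx => by
    have hTx := (hTs x).2 hx
    simp only [φ, dif_pos hx, dif_pos hTx]
    rfl)
  obtain ⟨z, rfl⟩ := SeparationQuotient.surjective_mk w
  refine ⟨z, ?_⟩
  filter_upwards [hw, hsμ] with x hx hxs
  simp only [φ, dif_pos hxs, SeparationQuotient.mk_eq_mk, Metric.inseparable_iff, hdist] at hx
  rw [hcomm, hx]

/-- The asymptotic distance of the orbits of `x` and `y`, with `d` truncated at `1`. -/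
noncomputable def asymptoticDist {X : Type*} (d : X → X → ℝ) (T : X → X) (x y : X) : ℝ :=
  limsup (fun n : ℕ => min (d (T^[n] x) (T^[n] y)) 1) atTop

namespace IsMetricFun

variable {X : Type*} {d : X → X → ℝ} {T : X → X}

theorem nonneg (hd : IsMetricFun d) (x y : X) : 0 ≤ d x y := by
  have := hd.2.2.2 x y x
  rw [hd.1, hd.2.2.1 y x] at this
  linarith

theorem isBoundedUnder_le_asymptoticDist (x y : X) :
    IsBoundedUnder (· ≤ ·) atTop fun n : ℕ => min (d (T^[n] x) (T^[n] y)) 1 :=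
  isBoundedUnder_of ⟨1, fun _ => min_le_right _ _⟩

theorem isBoundedUnder_ge_asymptoticDist (hd : IsMetricFun d) (x y : X) :
    IsBoundedUnder (· ≥ ·) atTop fun n : ℕ => min (d (T^[n] x) (T^[n] y)) 1 :=
  isBoundedUnder_of ⟨0, fun _ => le_min (hd.nonneg _ _) zero_le_one⟩

theorem asymptoticDist_self (hd : IsMetricFun d) (x : X) : asymptoticDist d T x x = 0 := by
  simp [asymptoticDist, hd.1]

theorem asymptoticDist_comm (hd : IsMetricFun d) (x y : X) :
    asymptoticDist d T x y = asymptoticDist d T y x := by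
  simp only [asymptoticDist, hd.2.2.1]

theorem asymptoticDist_triangle (hd : IsMetricFun d) (x y z : X) :
    asymptoticDist d T x z ≤ asymptoticDist d T x y + asymptoticDist d T y z := by
  have hle := isBoundedUnder_le_asymptoticDist (d := d) (T := T)
  have hge := hd.isBoundedUnder_ge_asymptoticDist (T := T)
  refine (limsup_le_limsup (Eventually.of_forall fun n => ?_) (hge x z).isCoboundedUnder_le
    (isBoundedUnder_le_add (hle x y) (hle y z))).trans
    (limsup_add_le (hge x y) (hle x y) (hge y z).isCoboundedUnder_le (hle y z))
  have h1 := hd.2.2.2 (T^[n] x) (T^[n] y) (T^[n] z)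
  have h2 := hd.nonneg (T^[n] x) (T^[n] y)
  have h3 := hd.nonneg (T^[n] y) (T^[n] z)
  simp only [Pi.add_apply]
  grind

theorem asymptoticDist_apply_apply (x y : X) :
    asymptoticDist d T (T x) (T y) = asymptoticDist d T x y := by
  simp only [asymptoticDist, ← Function.iterate_succ_apply]
  exact limsup_nat_add (fun n : ℕ => min (d (T^[n] x) (T^[n] y)) 1) 1

theorem measurable_asymptoticDist [MeasurableSpace X] (hT : Measurable T)
    (hmeas : Measurable fun p : X × X => d p.1 p.2) :
    Measurable fun p : X × X => asymptoticDist d T p.1 p.2 :=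
  Measurable.limsup fun n => (hmeas.comp (((hT.iterate n).comp measurable_fst).prodMk
    ((hT.iterate n).comp measurable_snd))).min measurable_const

theorem asymptoticDist_le_limsup (hd : IsMetricFun d) {δ : ℝ} {x y : X}
    (h : δ < asymptoticDist d T x y) :
    (δ : EReal) ≤ limsup (fun n : ℕ => ((d (T^[n] x) (T^[n] y) : ℝ) : EReal)) atTop := by
  refine le_limsup_of_frequently_le ((frequently_lt_of_lt_limsup
    (hd.isBoundedUnder_ge_asymptoticDist x y).isCoboundedUnder_le h).mono fun n hn => ?_)
  exact EReal.coe_le_coe_iff.2 (hn.trans_le (min_le_left _ _)).le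

end IsMetricFun

/-- A conservative map moving almost every point asymptotically by zero `d`-distance is
almost everywhere the identity. -/
theorem MeasureTheory.Conservative.ae_eq_self_of_asymptoticDist {X : Type*} [MeasurableSpace X]
    {μ : Measure X} {T : X → X} (hT : Conservative T μ) {d : X → X → ℝ} (hd : IsMetricFun d)
    (hmeas : Measurable fun p : X × X => d p.1 p.2)
    (h : ∀ᵐ x ∂μ, asymptoticDist d T x (T x) = 0) : ∀ᵐ x ∂μ, T x = x := by
  have hA : ∀ k : ℕ, MeasurableSet {x | 1 / ((k : ℝ) + 1) < d x (T x)} := fun k =>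
    measurableSet_lt measurable_const (hmeas.comp (measurable_id.prodMk hT.measurable))
  have hrec : ∀ᵐ x ∂μ, ∀ k : ℕ, 1 / ((k : ℝ) + 1) < d x (T x) →
      ∃ᶠ n in atTop, 1 / ((k : ℝ) + 1) < d (T^[n] x) (T (T^[n] x)) :=
    ae_all_iff.2 fun k => hT.ae_mem_imp_frequently_image_mem (hA k).nullMeasurableSet
  filter_upwards [h, hrec] with x hx hxrec
  by_contra hne
  have hpos : 0 < d x (T x) := (hd.nonneg _ _).lt_of_ne' fun h0 => hne (hd.2.1 _ _ h0).symm
  obtain ⟨k, hk⟩ := exists_nat_one_div_lt hpos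
  have hk1 : (0 : ℝ) < 1 / ((k : ℝ) + 1) := by positivity
  have hev := eventually_lt_of_limsup_lt (hx.trans_lt (lt_min hk1 one_pos))
    (IsMetricFun.isBoundedUnder_le_asymptoticDist x (T x))
  obtain ⟨n, hn, hn'⟩ := ((hxrec k hk).and_eventually hev).exists
  rw [← Function.iterate_succ_apply, Function.iterate_succ_apply', lt_min_iff] at hn'
  rcases min_lt_iff.1 hn'.1 with h1 | h1
  · exact hn.not_gt h1
  · exact (lt_irrefl (1 : ℝ)) (by
      rcases min_lt_iff.1 hn'.2 with h2 | h2
      · linarith [hn'.1]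
      · exact h2)

/-- An invertible conservative ergodic nonsingular transformation of a nonatomic σ-finite
standard Borel measure space which is ergodic with isometric coefficients is W-measurably
sensitive. -/
theorem eic_implies_wMeasurablySensitive {X : Type*} [MeasurableSpace X]
    [StandardBorelSpace X] (μ : Measure X) [SigmaFinite μ]
    (hna : ∀ x : X, μ {x} = 0) (T : X ≃ᵐ X)
    (hns : Measure.QuasiMeasurePreserving (⇑T) μ μ)
    (hns' : Measure.QuasiMeasurePreserving (⇑T.symm) μ μ)
    (hcons : IsConservative μ T) (herg : IsErgodicT μ T)
    (heic : EIC μ T) :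
    WMeasurablySensitive μ T := by
  rintro d ⟨hd, hmeas, -⟩
  rcases eq_zero_or_neZero μ with rfl | hμ
  · exact ⟨1, one_pos, by simp⟩
  by_contra hsens
  obtain ⟨D, hD⟩ : ∃ D, D = asymptoticDist d T := ⟨_, rfl⟩
  have hDmeas : Measurable fun p : X × X => D p.1 p.2 :=
    hD ▸ IsMetricFun.measurable_asymptoticDist T.measurable hmeas
  have hDmeas_left : ∀ x, Measurable (D x) := fun x => hDmeas.comp measurable_prodMk_left
  have hinv : ∀ x y, D (T x) (T y) = D x y := hD ▸ IsMetricFun.asymptoticDist_apply_apply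
  let A : ℕ → Set X := fun k => {x | μ {y | D x y < 1 / ((k : ℝ) + 1)} = 0}
  have hAmeas : ∀ k, MeasurableSet (A k) := fun k =>
    measurable_measure_prodMk_left (measurableSet_lt hDmeas measurable_const)
      (measurableSet_singleton 0)
  have hAinv : ∀ k x, T x ∈ A k ↔ x ∈ A k := fun k x => by
    have hpre : {y | D x y < 1 / ((k : ℝ) + 1)} = T ⁻¹' {y | D (T x) y < 1 / ((k : ℝ) + 1)} := by
      ext y
      simp only [mem_preimage, mem_ofPred_eq, hinv]
    have hpre' : {y | D (T x) y < 1 / ((k : ℝ) + 1)} =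
        T.symm ⁻¹' {y | D x y < 1 / ((k : ℝ) + 1)} := by
      ext y
      rw [mem_preimage, mem_ofPred_eq, mem_ofPred_eq, ← hinv x, T.apply_symm_apply]
    refine ⟨fun h => ?_, fun h => ?_⟩
    · change μ _ = 0
      rw [hpre]
      exact hns.preimage_null h
    · change μ _ = 0
      rw [hpre']
      exact hns'.preimage_null h
  have hAnull : ∀ k, μ (A k) = 0 := fun k => by
    refine (herg (A k) (hAmeas k) (Set.ext (hAinv k))).resolve_right fun hk => hsens ?_
    have hk1 : (0 : ℝ) < 1 / ((k : ℝ) + 1) := by positivity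
    refine ⟨1 / ((k : ℝ) + 1) / 4, by positivity, ?_⟩
    have hkae : ∀ᵐ x ∂μ, x ∈ A k := hk
    filter_upwards [hkae] with x hx
    have hxae : ∀ᵐ y ∂μ, ¬ D x y < 1 / ((k : ℝ) + 1) := by
      simp only [ae_iff, not_not]
      exact hx
    filter_upwards [hxae] with y hy
    refine lt_of_lt_of_le (EReal.coe_lt_coe_iff.2 ?_)
      (hd.asymptoticDist_le_limsup (δ := 1 / ((k : ℝ) + 1) / 2) ?_)
    · linarith
    · rw [← hD]
      have := not_lt.1 hy
      linarith
  obtain ⟨z, hz⟩ := heic.exists_ae_eq_zero (D := D) (s := ⋂ k, (A k)ᶜ)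
    (hD ▸ hd.asymptoticDist_self) (hD ▸ hd.asymptoticDist_comm) (hD ▸ hd.asymptoticDist_triangle)
    hDmeas_left hinv
    (MeasurableSet.iInter fun k => (hAmeas k).compl)
    (fun x => by simp only [mem_iInter, mem_compl_iff, hAinv])
    (by
      simp only [mem_iInter]
      exact ae_all_iff.2 fun k => measure_eq_zero_iff_ae_notMem.1 (hAnull k))
    (fun x hx ε hε => by
      obtain ⟨k, hk⟩ := exists_nat_one_div_lt hε
      refine (pos_iff_ne_zero.2 (mem_iInter.1 hx k)).trans_le (measure_mono fun y hy => ?_)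
      exact lt_trans hy hk)
  have hTcons : Conservative T μ := ⟨hns, fun s hs h0 => by
    obtain ⟨n, hn, hpos⟩ := hcons s hs (pos_iff_ne_zero.2 h0)
    obtain ⟨x, hx, hx'⟩ := nonempty_of_measure_ne_zero hpos.ne'
    exact ⟨x, hx, n, Nat.one_le_iff_ne_zero.1 hn, hx'⟩⟩
  have hfix : ∀ᵐ x ∂μ, T x = x := by
    refine hTcons.ae_eq_self_of_asymptoticDist hd hmeas ?_
    filter_upwards [hz, hns.ae hz] with x hx hTx
    have h1 := hd.asymptoticDist_triangle (T := T) x z (T x)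
    have h2 := hd.asymptoticDist_triangle (T := T) x (T x) x
    rw [hd.asymptoticDist_self, hd.asymptoticDist_comm (T x) x] at h2
    rw [hd.asymptoticDist_comm x z] at h1
    simp only [hD] at hx hTx
    linarith
  obtain ⟨c, hc⟩ := heic ℝ (IsometryEquiv.refl ℝ) (embeddingReal X) (measurable_embeddingReal X)
    (hfix.mono fun x hx => congrArg (embeddingReal X) hx)
  obtain ⟨a, ha⟩ := hc.exists
  have hconst : ∀ᵐ x ∂μ, x ∈ ({a} : Set X) := hc.mono fun x hx =>
    (measurableEmbedding_embeddingReal X).injective (hx.trans ha.symm)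
  refine NeZero.ne μ (Measure.measure_univ_eq_zero.1 ?_)
  rw [← hna a]
  exact (measure_congr (eventuallyEq_univ.2 hconst)).symm
end

section
/- There exist a σ-finite measure space (X,μ) with μ nonatomic and μ(X) = ∞, an invertible measure-preserving conservative ergodic transformation T of (X,μ) that is Koopman mixing (for all measurable sets A, B of finite measure, lim_{n→∞} μ(Tⁿ(A) ∩ B) = 0), and a measurable set E ⊆ X with μ(E) > 0 and μ(X∖E) > 0 such that T⁻¹(E) coincides with X∖E up to a μ-null set; in particular T is not weak mixing. -/
open MeasureTheory Filter Set
open scoped ENNReal symmDiff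

open scoped Topology

/-- An undelayed renewal sequence whose waiting time has tail function `F`, charges `d + 1`, and
has divergent tail sum along the multiples of `d + 1`, tends to zero. -/
theorem tendsto_zero_of_renewal {a F : ℕ → ℝ} {d : ℕ} (hF : Antitone F) (hF0 : F 0 = 1)
    (hFnn : ∀ n, 0 ≤ F n) (ha0 : a 0 = 1)
    (ha : ∀ n, a (n + 1) = ∑ j ∈ Finset.range (n + 1), (F j - F (j + 1)) * a (n - j))
    (hd : F (d + 1) < F d) (hdiv : ¬ Summable fun i => F ((d + 1) * i)) :
    Tendsto a atTop (𝓝 0) := by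
  have hg : ∀ j, 0 ≤ F j - F (j + 1) := fun j => sub_nonneg.2 (hF j.le_succ)
  have hann : ∀ n, 0 ≤ a n := by
    intro n
    induction n using Nat.strong_induction_on with
    | _ n ih =>
      cases n with
      | zero => simp [ha0]
      | succ n =>
        rw [ha]
        exact Finset.sum_nonneg fun j _ => mul_nonneg (hg j) (ih _ (by omega))
  have hw : ∀ n, ∑ j ∈ Finset.range (n + 1), F j * a (n - j) = 1 := by
    intro n
    induction n with
    | zero => simp [hF0, ha0]
    | succ n ih =>
      rw [Finset.sum_range_succ', ← ih]
      simp only [hF0, Nat.sub_zero, one_mul, ha, sub_mul, Finset.sum_sub_distrib,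
        Nat.add_sub_add_right]
      ring
  have hw_le : ∀ (s : Finset ℕ) n, (∀ j ∈ s, j ≤ n) → ∑ j ∈ s, F j * a (n - j) ≤ 1 := by
    intro s n hs
    rw [← hw n]
    exact Finset.sum_le_sum_of_subset_of_nonneg (fun j hj => by simpa [Nat.lt_succ_iff] using hs j hj)
      fun j _ _ => mul_nonneg (hFnn j) (hann _)
  have ha1 : ∀ n, a n ∈ Icc (0 : ℝ) 1 := fun n =>
    ⟨hann n, by simpa [hF0] using hw_le {0} n (by simp)⟩
  have hgsum : ∀ n, ∑ j ∈ Finset.range n, (F j - F (j + 1)) ≤ 1 := by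
    intro n
    rw [Finset.sum_range_sub', hF0]
    linarith [hFnn n]
  have hgs : Summable fun j => F j - F (j + 1) := summable_of_sum_range_le hg hgsum
  have hgt : ∑' j, (F j - F (j + 1)) ≤ 1 := hgs.tsum_le_of_sum_range_le hgsum
  have hKc : IsCompact {x | MapClusterPt x atTop a} :=
    isCompact_Icc.of_isClosed_subset isClosed_setOfPred_clusterPt fun x hx =>
      isClosed_Icc.mem_of_mapClusterPt hx (Eventually.of_forall ha1)
  obtain ⟨x₀, -, hx₀⟩ := isCompact_Icc.exists_mapClusterPt_of_frequently
    (Eventually.of_forall ha1 : ∀ᶠ n in atTop, a n ∈ Icc (0 : ℝ) 1).frequently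
  obtain ⟨l, hl, hmax⟩ := hKc.exists_isGreatest ⟨x₀, hx₀⟩
  have hshift : ∀ (V : Ultrafilter ℕ) (m : ℕ), (V : Filter ℕ) ≤ atTop →
      Tendsto (fun n => n - m) V atTop := fun V m hV => (tendsto_sub_atTop_nat m).mono_left hV
  have hstep : ∀ V : Ultrafilter ℕ, (V : Filter ℕ) ≤ atTop → Tendsto a V (𝓝 l) →
      Tendsto (fun n => a (n - (d + 1))) V (𝓝 l) := by
    intro V hV hVl
    have hb : ∀ j : ℕ, ∃ b, Tendsto (fun n : ℕ => a (n - (j + 1))) V (𝓝 b) := by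
      intro j
      obtain ⟨b, -, hb⟩ := isCompact_Icc.ultrafilter_le_nhds
        (V.map fun n => a (n - (j + 1))) (s := Icc (0 : ℝ) 1)
        (le_principal_iff.2 (Ultrafilter.mem_map.2
          (Eventually.of_forall fun n => ha1 (n - (j + 1)))))
      exact ⟨b, hb⟩
    choose b hb using hb
    have hbl : ∀ j, b j ≤ l := fun j =>
      hmax ((hb j).mapClusterPt.of_comp (φ := fun n => n - (j + 1)) (hshift V (j + 1) hV))
    have hb0 : ∀ j, 0 ≤ b j := fun j => ge_of_tendsto' (hb j) fun n => hann _
    have hlim : Tendsto (fun n : ℕ => ∑' j : ℕ, if j < n then (F j - F (j + 1)) * a (n - (j + 1)) else 0) V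
        (𝓝 (∑' j, (F j - F (j + 1)) * b j)) := by
      refine tendsto_tsum_of_dominated_convergence hgs (fun j => ?_) (Eventually.of_forall fun n j => ?_)
      · refine ((hb j).const_mul _).congr' ?_
        filter_upwards [hV (eventually_gt_atTop j)] with n hn
        simp [hn]
      · split_ifs
        · rw [Real.norm_of_nonneg (mul_nonneg (hg j) (hann _))]
          exact mul_le_of_le_one_right (hg j) (ha1 _).2
        · simpa using hg j
    have hl_eq : l = ∑' j, (F j - F (j + 1)) * b j := by
      refine tendsto_nhds_unique (hVl.congr' ?_) hlim
      filter_upwards [hV (eventually_gt_atTop 0)] with n hn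
      obtain ⟨n, rfl⟩ := Nat.exists_eq_succ_of_ne_zero hn.ne'
      rw [tsum_eq_sum (s := Finset.range (n + 1)) (fun j hj => by simp at hj; simp; omega), Nat.succ_eq_add_one, ha]
      refine Finset.sum_congr rfl fun j hj => ?_
      simp only [Finset.mem_range] at hj
      simp [hj]
    have hbd : b d = l := by
      by_contra hne
      have hlt : b d < l := lt_of_le_of_ne (hbl d) hne
      have hl0 : 0 ≤ l := (hb0 d).trans (hbl d)
      have := Summable.tsum_lt_tsum (f := fun j => (F j - F (j + 1)) * b j)
        (g := fun j => (F j - F (j + 1)) * l) (i := d)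
        (fun j => mul_le_mul_of_nonneg_left (hbl j) (hg j))
        (mul_lt_mul_of_pos_left hlt (sub_pos.2 hd))
        (Summable.of_nonneg_of_le (fun j => mul_nonneg (hg j) (hb0 j))
          (fun j => mul_le_mul_of_nonneg_left (hbl j) (hg j)) (hgs.mul_right l)) (hgs.mul_right l)
      rw [tsum_mul_right, ← hl_eq] at this
      nlinarith
    exact hbd ▸ hb d
  obtain ⟨U, hU, hUl⟩ := mapClusterPt_iff_ultrafilter.1 hl
  have hiter : ∀ i, Tendsto (fun n => a (n - (d + 1) * i)) U (𝓝 l) := by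
    intro i
    induction i with
    | zero => simpa using hUl
    | succ i ih =>
      have := hstep (U.map fun n => n - (d + 1) * i) (hshift U _ hU) ih
      refine (tendsto_map'_iff.1 this).congr fun n => ?_
      simp only [Function.comp, mul_add, mul_one, Nat.sub_sub]
  have hl0 : 0 ≤ l := ge_of_tendsto' hUl hann
  have hl_eq : l = 0 := by
    by_contra hne
    have hlpos : 0 < l := lt_of_le_of_ne hl0 (Ne.symm hne)
    refine hdiv (summable_of_sum_range_le (c := 1 / l) (fun i => hFnn _) fun N => ?_)
    rw [le_div_iff₀ hlpos, Finset.sum_mul]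
    refine le_of_tendsto (tendsto_finsetSum _ fun i _ => (hiter i).const_mul (F ((d + 1) * i))) ?_
    filter_upwards [hU (eventually_ge_atTop ((d + 1) * N))] with n hn
    have := hw_le ((Finset.range N).image fun i => (d + 1) * i) n (by
      intro j hj
      obtain ⟨i, hi, rfl⟩ := Finset.mem_image.1 hj
      exact (Nat.mul_le_mul_left _ (Finset.mem_range.1 hi).le).trans hn)
    rwa [Finset.sum_image fun x _ y _ h => Nat.eq_of_mul_eq_mul_left d.succ_pos h] at this
  refine isCompact_Icc.tendsto_nhds_of_unique_mapClusterPt (Eventually.of_forall ha1) fun x hx hxc => ?_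
  exact le_antisymm (hl_eq ▸ hmax hxc) hx.1

/-- The shift on bi-infinite sequences. -/
def shiftEquiv (α : Type*) [MeasurableSpace α] : (ℤ → α) ≃ᵐ (ℤ → α) where
  toFun ω i := ω (i + 1)
  invFun ω i := ω (i - 1)
  left_inv ω := by simp
  right_inv ω := by simp
  measurable_toFun := by simp only [Equiv.coe_fn_mk]; fun_prop
  measurable_invFun := by simp only [Equiv.coe_fn_symm_mk]; fun_prop

section Bernoulli

variable {α : Type*} [MeasurableSpace α]

@[simp]
theorem shiftEquiv_apply (ω : ℤ → α) (i : ℤ) : shiftEquiv α ω i = ω (i + 1) := rfl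

theorem shiftEquiv_iterate_apply (n : ℕ) (ω : ℤ → α) (i : ℤ) :
    (shiftEquiv α)^[n] ω i = ω (i + n) := by
  induction n generalizing ω with
  | zero => simp
  | succ n ih =>
    rw [Function.iterate_succ_apply, ih, shiftEquiv_apply]
    push_cast
    ring_nf

theorem infinitePi_inter_cylinder {ι : Type*} (p : ι → Measure α) [∀ i, IsProbabilityMeasure (p i)]
    {s t : Finset ι} (hst : Disjoint s t) {S : Set (s → α)} {T : Set (t → α)}
    (hS : MeasurableSet S) (hT : MeasurableSet T) :
    Measure.infinitePi p (cylinder s S ∩ cylinder t T) =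
      Measure.infinitePi p (cylinder s S) * Measure.infinitePi p (cylinder t T) :=
  ((ProbabilityTheory.iIndepFun_infinitePi (P := p) (X := fun _ x => x)
    fun _ => measurable_id).indepFun_finset s t hst
      fun i => measurable_pi_apply i).measure_inter_preimage_eq_mul S T hS hT

variable (p : Measure α) [IsProbabilityMeasure p]

theorem measurePreserving_shiftEquiv :
    MeasurePreserving (shiftEquiv α) (Measure.infinitePi fun _ => p)
      (Measure.infinitePi fun _ => p) where
  measurable := (shiftEquiv α).measurable
  map_eq := Measure.map_infinitePi_infinitePi_of_inj (P := fun _ : ℤ => p) (add_left_injective (1 : ℤ))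

theorem exists_shiftEquiv_preimage_cylinder {s : Finset ℤ} {S : Set (s → α)} (hS : MeasurableSet S)
    (n : ℕ) : ∃ S' : Set (↥(s.image (· + (n : ℤ))) → α), MeasurableSet S' ∧
      (shiftEquiv α)^[n] ⁻¹' cylinder (α := fun _ => α) s S = cylinder (α := fun _ => α) (s.image (· + (n : ℤ))) S' := by
  refine ⟨(fun ω (i : s) => ω ⟨i + n, Finset.mem_image_of_mem (· + (n : ℤ)) i.2⟩) ⁻¹' S,
    hS.preimage (measurable_pi_lambda _ fun i => measurable_pi_apply _), ?_⟩
  ext ω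
  simp only [mem_preimage, mem_cylinder]
  rw [show s.restrict ((shiftEquiv α)^[n] ω) = fun i : s => ω (i + n) from
    funext fun i => shiftEquiv_iterate_apply n ω i]
  rfl

theorem ergodic_shiftEquiv : Ergodic (shiftEquiv α) (Measure.infinitePi fun _ => p) := by
  set P := Measure.infinitePi fun _ : ℤ => p with hP
  have hmp : MeasurePreserving (shiftEquiv α) P P := measurePreserving_shiftEquiv p
  refine ⟨hmp, ⟨fun A hA hAinv => ?_⟩⟩
  have hdense : P.MeasureDense (measurableCylinders fun _ : ℤ => α) :=
    .of_generateFrom_isSetAlgebra_finite P isSetAlgebra_measurableCylinders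
      generateFrom_measurableCylinders.symm
  have hsq : P.real A = P.real A * P.real A := by
    refine eq_of_forall_dist_le fun ε hε => ?_
    obtain ⟨C, hC, hAC⟩ := hdense.approx A hA (measure_ne_top _ _) (ε / 4) (by positivity)
    have hCm : MeasurableSet C := hdense.measurable C hC
    replace hAC : P.real (A ∆ C) < ε / 4 := (ENNReal.lt_ofReal_iff_toReal_lt (measure_ne_top _ _)).1 hAC
    obtain ⟨s, S, hS, rfl⟩ := (mem_measurableCylinders C).1 hC
    set C := cylinder (α := fun _ : ℤ => α) s S
    obtain ⟨n, hn⟩ : ∃ n : ℕ, Disjoint s (s.image (· + (n : ℤ))) := by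
      obtain ⟨M, hM⟩ := (s.image Int.natAbs).bddAbove
      refine ⟨2 * M + 1, Finset.disjoint_left.2 fun i hi hi' => ?_⟩
      obtain ⟨j, hj, rfl⟩ := Finset.mem_image.1 hi'
      have h1 := hM (Finset.mem_coe.2 (Finset.mem_image_of_mem Int.natAbs hi))
      have h2 := hM (Finset.mem_coe.2 (Finset.mem_image_of_mem Int.natAbs hj))
      omega
    obtain ⟨S', hS', hCS'⟩ := exists_shiftEquiv_preimage_cylinder hS n
    have hind : P.real (C ∩ (shiftEquiv α)^[n] ⁻¹' C) = P.real C * P.real C := by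
      have h1 : P ((shiftEquiv α)^[n] ⁻¹' C) = P C :=
        (hmp.iterate n).measure_preimage hCm.nullMeasurableSet
      rw [measureReal_def, hCS', infinitePi_inter_cylinder _ hn hS hS', ← hCS', ← hP, h1,
        ENNReal.toReal_mul, measureReal_def]
    have hAn : (shiftEquiv α)^[n] ⁻¹' A = A := Function.IsFixedPt.preimage_iterate hAinv n
    have hshift : P.real (A ∆ ((shiftEquiv α)^[n] ⁻¹' C)) = P.real (A ∆ C) := by
      conv_lhs => rw [← hAn, ← preimage_symmDiff]
      exact congrArg ENNReal.toReal
        ((hmp.iterate n).measure_preimage (hA.symmDiff hCm).nullMeasurableSet)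
    have hCn : MeasurableSet ((shiftEquiv α)^[n] ⁻¹' C) := (hmp.iterate n).measurable hCm
    have h1 : |P.real A - P.real C| ≤ P.real (A ∆ C) := abs_measureReal_sub_le_measureReal_symmDiff hA.nullMeasurableSet hCm.nullMeasurableSet
    have h2 : |P.real A - P.real (C ∩ (shiftEquiv α)^[n] ⁻¹' C)| ≤ P.real (A ∆ C) + P.real (A ∆ C) := by
      refine (abs_measureReal_sub_le_measureReal_symmDiff hA.nullMeasurableSet (hCm.inter hCn).nullMeasurableSet).trans ?_
      nth_rw 2 [← hshift]
      refine le_trans (measureReal_mono ?_) (measureReal_union_le _ _)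
      intro x
      simp only [mem_symmDiff, mem_inter_iff, mem_union]
      tauto
    rw [hind] at h2
    have h3 : |P.real A| ≤ 1 := by rw [abs_of_nonneg measureReal_nonneg]; exact measureReal_le_one
    have h4 : |P.real C| ≤ 1 := by rw [abs_of_nonneg measureReal_nonneg]; exact measureReal_le_one
    rw [Real.dist_eq]
    rw [abs_le] at *
    constructor <;> nlinarith
  rw [eventuallyConst_set']
  rcases eq_or_ne (P.real A) 0 with h0 | h0
  · exact Or.inl (ae_eq_empty.2 ((measureReal_eq_zero_iff).1 h0))
  · refine Or.inr (ae_eq_univ.2 ?_)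
    have h1 : P.real A = 1 := (mul_left_cancel₀ h0 (by rw [← hsq, mul_one])).symm
    rw [prob_compl_eq_zero_iff hA]
    exact (ENNReal.toReal_eq_one_iff _).1 h1

end Bernoulli

section Tower

variable {Ω : Type*} [MeasurableSpace Ω]

/-- The tower below the graph of a height function `h`. -/
def towerSet (h : Ω → ℕ) : Set (Ω × ℕ) := {x | x.2 < h x.1}

/-- The restriction of `P × counting` to the tower below the graph of `h`. -/
noncomputable def towerMeasure (P : Measure Ω) (h : Ω → ℕ) : Measure (Ω × ℕ) :=
  (P.prod Measure.count).restrict (towerSet h)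

/-- The Kakutani skyscraper over `σ` with height function `h`, extended by the identity
outside of the tower. -/
def towerMap (σ : Ω ≃ᵐ Ω) (h : Ω → ℕ) (x : Ω × ℕ) : Ω × ℕ :=
  if x.2 + 1 < h x.1 then (x.1, x.2 + 1) else if x.2 + 1 = h x.1 then (σ x.1, 0) else x

/-- The inverse of `towerMap`. -/
def towerMapInv (σ : Ω ≃ᵐ Ω) (h : Ω → ℕ) (x : Ω × ℕ) : Ω × ℕ :=
  if h x.1 ≤ x.2 then x else
    if x.2 = 0 then (σ.symm x.1, h (σ.symm x.1) - 1) else (x.1, x.2 - 1)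

variable {σ : Ω ≃ᵐ Ω} {h : Ω → ℕ}

theorem measurableSet_towerSet (hh : Measurable h) : MeasurableSet (towerSet h) :=
  measurableSet_lt measurable_snd (hh.comp measurable_fst)

theorem measurable_towerMap (hh : Measurable h) : Measurable (towerMap σ h) :=
  Measurable.ite (measurableSet_lt (by fun_prop) (by fun_prop)) (by fun_prop)
    (Measurable.ite (measurableSet_eq_fun (by fun_prop) (by fun_prop)) (by fun_prop) measurable_id)

theorem measurable_towerMapInv (hh : Measurable h) : Measurable (towerMapInv σ h) :=
  Measurable.ite (measurableSet_le (by fun_prop) (by fun_prop)) measurable_id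
    (Measurable.ite (measurableSet_eq_fun (by fun_prop) (by fun_prop)) (by fun_prop)
      (by fun_prop))

theorem towerMapInv_towerMap (hpos : ∀ ω, 0 < h ω) (x : Ω × ℕ) :
    towerMapInv σ h (towerMap σ h x) = x := by
  obtain ⟨ω, j⟩ := x
  rcases lt_trichotomy (j + 1) (h ω) with hj | hj | hj
  · simp [towerMap, towerMapInv, hj]
  · have : h ω - 1 = j := by omega
    simp [towerMap, towerMapInv, hj, (hpos _).ne', this]
  · simp [towerMap, towerMapInv, hj.not_gt, hj.ne', show h ω ≤ j by omega]

theorem towerMap_towerMapInv (hpos : ∀ ω, 0 < h ω) (x : Ω × ℕ) :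
    towerMap σ h (towerMapInv σ h x) = x := by
  obtain ⟨ω, j⟩ := x
  by_cases hj : h ω ≤ j
  · simp [towerMap, towerMapInv, hj, show ¬ j + 1 < h ω by omega, show j + 1 ≠ h ω by omega]
  · rcases j with _ | j
    · have := hpos (σ.symm ω)
      simp [towerMap, towerMapInv, (hpos _).ne', Nat.sub_add_cancel this]
    · simp [towerMap, towerMapInv, hj, lt_of_not_ge hj]

theorem towerMap_injective (hpos : ∀ ω, 0 < h ω) : Function.Injective (towerMap σ h) :=
  Function.LeftInverse.injective (towerMapInv_towerMap hpos)

/-- The Kakutani skyscraper as a measurable equivalence. -/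
def towerEquiv (σ : Ω ≃ᵐ Ω) (hh : Measurable h) (hpos : ∀ ω, 0 < h ω) : Ω × ℕ ≃ᵐ Ω × ℕ where
  toFun := towerMap σ h
  invFun := towerMapInv σ h
  left_inv := towerMapInv_towerMap hpos
  right_inv := towerMap_towerMapInv hpos
  measurable_toFun := measurable_towerMap hh
  measurable_invFun := measurable_towerMapInv hh

theorem towerMap_of_lt {ω : Ω} {j : ℕ} (hj : j + 1 < h ω) : towerMap σ h (ω, j) = (ω, j + 1) :=
  if_pos hj

theorem towerMap_of_eq {ω : Ω} {j : ℕ} (hj : j + 1 = h ω) : towerMap σ h (ω, j) = (σ ω, 0) := by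
  simp [towerMap, hj]

theorem towerMap_of_notMem {x : Ω × ℕ} (hx : x ∉ towerSet h) : towerMap σ h x = x := by
  simp only [towerSet, mem_ofPred_eq, not_lt] at hx
  simp [towerMap, show ¬ x.2 + 1 < h x.1 by omega, show x.2 + 1 ≠ h x.1 by omega]

theorem towerMap_mem_towerSet_iff (hpos : ∀ ω, 0 < h ω) (x : Ω × ℕ) :
    towerMap σ h x ∈ towerSet h ↔ x ∈ towerSet h := by
  by_cases hx : x ∈ towerSet h
  · refine iff_of_true ?_ hx
    obtain ⟨ω, j⟩ := x
    rcases (Nat.succ_le_of_lt hx).lt_or_eq with hj | hj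
    · rwa [towerMap_of_lt hj]
    · rw [towerMap_of_eq hj]
      exact hpos _
  · rw [towerMap_of_notMem hx]

theorem towerMap_iterate_of_lt {ω : Ω} {j : ℕ} (hj : j < h ω) :
    (towerMap σ h)^[j] (ω, 0) = (ω, j) := by
  induction j with
  | zero => rfl
  | succ j ih =>
    rw [Function.iterate_succ_apply', ih (by omega), towerMap_of_lt hj]

theorem towerMap_iterate_height (hpos : ∀ ω, 0 < h ω) (ω : Ω) :
    (towerMap σ h)^[h ω] (ω, 0) = (σ ω, 0) := by
  obtain ⟨j, hj⟩ := Nat.exists_eq_succ_of_ne_zero (hpos ω).ne'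
  rw [hj, Function.iterate_succ_apply', towerMap_iterate_of_lt (by omega),
    towerMap_of_eq hj.symm]

theorem exists_towerMap_iterate_eq (hpos : ∀ ω, 0 < h ω) (m : ℕ) (ω : Ω) :
    ∃ n, m ≤ n ∧ (towerMap σ h)^[n] (ω, 0) = (σ^[m] ω, 0) := by
  induction m generalizing ω with
  | zero => exact ⟨0, le_rfl, rfl⟩
  | succ m ih =>
    obtain ⟨n, hn, hn'⟩ := ih (σ ω)
    refine ⟨n + h ω, add_le_add hn (hpos ω), ?_⟩
    rw [Function.iterate_add_apply, towerMap_iterate_height hpos, hn', Function.iterate_succ_apply]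

theorem towerMap_iterate_succ_snd_eq_zero_iff (hpos : ∀ ω, 0 < h ω) (n : ℕ) (ω : Ω) :
    ((towerMap σ h)^[n + 1] (ω, 0)).2 = 0 ↔
      ∃ j ∈ Finset.range (n + 1), h ω = j + 1 ∧ ((towerMap σ h)^[n - j] (σ ω, 0)).2 = 0 := by
  rcases lt_or_ge (n + 1) (h ω) with hn | hn
  · rw [towerMap_iterate_of_lt hn]
    simp only [Nat.add_eq_zero_iff, one_ne_zero, and_false, Finset.mem_range, false_iff]
    rintro ⟨j, hj, hj', -⟩
    omega
  · obtain ⟨j, hj⟩ := Nat.exists_eq_succ_of_ne_zero (hpos ω).ne'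
    have : (towerMap σ h)^[n + 1] (ω, 0) = (towerMap σ h)^[n - j] (σ ω, 0) := by
      rw [show n + 1 = n - j + h ω by omega, Function.iterate_add_apply,
        towerMap_iterate_height hpos]
    rw [this]
    constructor
    · exact fun H => ⟨j, by simp; omega, hj, H⟩
    · rintro ⟨i, -, hi, H⟩
      obtain rfl : i = j := by omega
      exact H

section Measure

variable {P : Measure Ω}

theorem towerMeasure_univ (hh : Measurable h) :
    towerMeasure P h univ = ∫⁻ ω, (h ω : ℝ≥0∞) ∂P := by
  rw [towerMeasure, Measure.restrict_apply_univ, Measure.prod_apply (measurableSet_towerSet hh)]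
  refine lintegral_congr fun ω => ?_
  have : Prod.mk ω ⁻¹' towerSet h = (Finset.range (h ω) : Set ℕ) := by
    ext j
    simp [towerSet]
  rw [this, Measure.count_apply_finset, Finset.card_range]

theorem towerMeasure_compl_towerSet (hh : Measurable h) :
    towerMeasure P h (towerSet h)ᶜ = 0 := by
  rw [towerMeasure, Measure.restrict_apply (measurableSet_towerSet hh).compl]
  simp

theorem towerMeasure_singleton [NullSingletonClass P] (x : Ω × ℕ) : towerMeasure P h {x} = 0 := by
  refine le_antisymm ((Measure.restrict_apply_le _ _).trans ?_) zero_le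
  rw [← Prod.mk.eta (p := x), ← singleton_prod_singleton, Measure.prod_prod]
  simp

variable [SFinite P]

theorem towerMeasure_apply (hh : Measurable h) {B : Set (Ω × ℕ)} (hB : MeasurableSet B) :
    towerMeasure P h B = ∑' j, P {ω | j < h ω ∧ (ω, j) ∈ B} := by
  rw [towerMeasure, Measure.restrict_apply hB,
    Measure.prod_apply_symm (hB.inter (measurableSet_towerSet hh)), lintegral_count]
  congr! 3 with j
  ext ω
  simp [towerSet, and_comm]

theorem measurePreserving_towerMap (hσ : MeasurePreserving σ P P) (hh : Measurable h)
    (hpos : ∀ ω, 0 < h ω) :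
    MeasurePreserving (towerMap σ h) (towerMeasure P h) (towerMeasure P h) := by
  refine ⟨measurable_towerMap hh, Measure.ext fun B hB => ?_⟩
  have hBj : ∀ j, MeasurableSet {ω | (ω, j) ∈ B} := fun j => hB.preimage (by fun_prop)
  have hsplit : ∀ j, P {ω | j < h ω ∧ (ω, j) ∈ towerMap σ h ⁻¹' B} =
      P {ω | j + 1 < h ω ∧ (ω, j + 1) ∈ B} + P {ω | h ω = j + 1 ∧ (σ ω, 0) ∈ B} := by
    intro j
    rw [← measure_union]
    · congr 1
      ext ω
      simp only [mem_ofPred_eq, mem_preimage, mem_union]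
      rcases lt_trichotomy (j + 1) (h ω) with hj | hj | hj
      · simp [towerMap_of_lt hj, hj, hj.ne', show j < h ω by omega]
      · simp [towerMap_of_eq hj, ← hj]
      · simp [hj.ne, hj.not_gt, show ¬ j < h ω by omega]
    · refine disjoint_left.2 fun ω h1 h2 => ?_
      exact absurd h2.1 h1.1.ne'
    · exact (measurableSet_eq_fun hh measurable_const).inter (σ.measurable (hBj 0))
  have hbase : ∑' j, P {ω | h ω = j + 1 ∧ (σ ω, 0) ∈ B} = P {ω | 0 < h ω ∧ (ω, 0) ∈ B} := by
    rw [← measure_iUnion]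
    · have h1 : ⋃ j, {ω | h ω = j + 1 ∧ (σ ω, 0) ∈ B} = σ ⁻¹' {ω | 0 < h ω ∧ (ω, 0) ∈ B} := by
        ext ω
        simp only [mem_iUnion, mem_ofPred_eq, mem_preimage, exists_and_right, hpos, true_and,
          and_iff_right_iff_imp]
        exact fun _ => ⟨h ω - 1, (Nat.sub_add_cancel (hpos ω)).symm⟩
      rw [h1, hσ.measure_preimage]
      exact ((measurableSet_lt measurable_const hh).inter (hBj 0)).nullMeasurableSet
    · intro i j hij
      refine disjoint_left.2 fun ω h1 h2 => hij ?_
      have := h1.1.symm.trans h2.1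
      omega
    · exact fun j => (measurableSet_eq_fun hh measurable_const).inter (σ.measurable (hBj 0))
  rw [Measure.map_apply (measurable_towerMap hh) hB,
    towerMeasure_apply hh (measurable_towerMap hh hB), towerMeasure_apply hh hB]
  simp_rw [hsplit]
  rw [ENNReal.tsum_add, hbase, tsum_eq_zero_add' (f := fun j => P {ω | j < h ω ∧ (ω, j) ∈ B})
    ENNReal.summable, add_comm]

theorem isConservative_towerMap [IsFiniteMeasure P] (hσ : MeasurePreserving σ P P)
    (hh : Measurable h) (hpos : ∀ ω, 0 < h ω) :
    IsConservative (towerMeasure P h) (towerMap σ h) := by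
  intro A hA hA0
  rw [towerMeasure_apply hh hA, pos_iff_ne_zero, Ne, ENNReal.tsum_eq_zero, not_forall] at hA0
  obtain ⟨j, hj⟩ := hA0
  set D := {ω | j < h ω ∧ (ω, j) ∈ A} with hD
  have hDm : MeasurableSet D :=
    (measurableSet_lt measurable_const hh).inter (hA.preimage (by fun_prop))
  obtain ⟨m, hm, hmD⟩ := hσ.conservative.exists_gt_measure_inter_ne_zero hDm.nullMeasurableSet hj 0
  have hsub : D ∩ σ^[m] ⁻¹' D ⊆
      ⋃ n : ℕ, {ω | j < h ω ∧ (ω, j) ∈ A ∩ (towerMap σ h)^[n + 1] ⁻¹' A} := by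
    rintro ω ⟨⟨h1, h2⟩, h3, h4⟩
    obtain ⟨n, hn, hn'⟩ := exists_towerMap_iterate_eq (σ := σ) hpos m ω
    obtain ⟨n, rfl⟩ := Nat.exists_eq_succ_of_ne_zero (by omega : n ≠ 0)
    refine mem_iUnion.2 ⟨n, h1, h2, ?_⟩
    rwa [mem_preimage, ← towerMap_iterate_of_lt (σ := σ) h1, ← Function.iterate_add_apply, add_comm,
      Function.iterate_add_apply, hn', towerMap_iterate_of_lt h3]
  by_contra! hcon
  refine hmD (measure_mono_null hsub (measure_iUnion_null fun n => ?_))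
  have := hcon (n + 1) (by omega)
  rw [nonpos_iff_eq_zero, towerMeasure_apply hh
    (hA.inter ((measurable_towerMap hh).iterate (n + 1) hA)), ENNReal.tsum_eq_zero] at this
  exact this j

theorem isErgodicT_towerMap (hσ : Ergodic σ P) (hh : Measurable h) (hpos : ∀ ω, 0 < h ω) :
    IsErgodicT (towerMeasure P h) (towerMap σ h) := by
  intro A hA hinv
  have hinv' : ∀ (n : ℕ) x, (towerMap σ h)^[n] x ∈ A ↔ x ∈ A := fun n x =>
    Set.ext_iff.1 (Function.IsFixedPt.preimage_iterate hinv n) x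
  have hlevel : ∀ j ω, j < h ω → ((ω, j) ∈ A ↔ (ω, 0) ∈ A) := fun j ω hj => by
    rw [← towerMap_iterate_of_lt (σ := σ) hj, hinv']
  have hbase := hσ.measure_self_or_compl_eq_zero (s := {ω | (ω, 0) ∈ A})
    (hA.preimage (by fun_prop)) (by
      ext ω
      rw [mem_preimage, mem_ofPred_eq, mem_ofPred_eq, ← towerMap_iterate_height hpos, hinv'])
  refine hbase.imp (fun H => ?_) fun H => ?_
  · rw [towerMeasure_apply hh hA, ENNReal.tsum_eq_zero]
    exact fun j => measure_mono_null (fun ω hω => (hlevel j ω hω.1).1 hω.2) H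
  · rw [towerMeasure_apply hh hA.compl, ENNReal.tsum_eq_zero]
    exact fun j => measure_mono_null (fun ω hω => mt (hlevel j ω hω.1).2 hω.2) H

theorem towerMeasure_image_iterate (hσ : MeasurePreserving σ P P) (hh : Measurable h)
    (hpos : ∀ ω, 0 < h ω) (n : ℕ) (B : Set (Ω × ℕ)) :
    towerMeasure P h ((towerMap σ h)^[n] '' B) = towerMeasure P h B := by
  induction n with
  | zero => simp
  | succ n ih =>
    rw [Function.iterate_succ', image_comp, ← ih]
    conv_rhs => rw [← (towerMap_injective (σ := σ) hpos).preimage_image ((towerMap σ h)^[n] '' B)]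
    exact ((measurePreserving_towerMap hσ hh hpos).measure_preimage_equiv
      (f := towerEquiv σ hh hpos) _).symm

theorem towerMeasure_image_level_inter_le (hσ : MeasurePreserving σ P P) (hh : Measurable h)
    (hpos : ∀ ω, 0 < h ω) {i j n : ℕ} (hjn : j ≤ n) :
    towerMeasure P h ((towerMap σ h)^[n] '' (towerSet h ∩ {x | x.2 = i}) ∩
      (towerSet h ∩ {x | x.2 = j})) ≤ P {ω | ((towerMap σ h)^[n + i - j] (ω, 0)).2 = 0} := by
  set m := n + i - j with hm
  have hms : MeasurableSet {x : Ω × ℕ | x.2 = 0 ∧ ((towerMap σ h)^[m] x).2 = 0} :=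
    (measurableSet_eq_fun measurable_snd measurable_const).inter
      (measurableSet_eq_fun (measurable_snd.comp ((measurable_towerMap hh).iterate m))
        measurable_const)
  have hsub : (towerMap σ h)^[n] '' (towerSet h ∩ {x | x.2 = i}) ∩ (towerSet h ∩ {x | x.2 = j}) ⊆
      (towerMap σ h)^[n + i] '' {x | x.2 = 0 ∧ ((towerMap σ h)^[m] x).2 = 0} := by
    rintro _ ⟨⟨⟨ω, k⟩, ⟨hi, rfl⟩, rfl⟩, hj, hj'⟩
    refine ⟨(ω, 0), ⟨rfl, ?_⟩, ?_⟩
    · have hinj := (towerMap_injective (σ := σ) hpos).iterate j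
      obtain ⟨ω', hω'⟩ : ∃ ω', (towerMap σ h)^[n] (ω, k) = (ω', j) := ⟨_, Prod.ext rfl hj'⟩
      rw [hω'] at hj
      have : (towerMap σ h)^[m] (ω, 0) = (ω', 0) := hinj (by
        rw [towerMap_iterate_of_lt (ω := ω') hj, ← hω', ← towerMap_iterate_of_lt (σ := σ) hi,
          ← Function.iterate_add_apply, ← Function.iterate_add_apply]
        rw [show j + m = n + k by omega])
      rw [this]
    · rw [Function.iterate_add_apply, towerMap_iterate_of_lt hi]
  refine (measure_mono hsub).trans ?_
  rw [towerMeasure_image_iterate hσ hh hpos, towerMeasure_apply hh hms,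
    tsum_eq_single 0 (fun k hk => by simp [hk])]
  exact measure_mono fun ω hω => hω.2.2

theorem tendsto_towerMeasure_image_iterate_inter (hσ : MeasurePreserving σ P P)
    (hh : Measurable h) (hpos : ∀ ω, 0 < h ω)
    (hzero : Tendsto (fun n => P {ω | ((towerMap σ h)^[n] (ω, 0)).2 = 0}) atTop (𝓝 0))
    {A B : Set (Ω × ℕ)} (hA : MeasurableSet A) (hB : MeasurableSet B)
    (hAfin : towerMeasure P h A < ∞) (hBfin : towerMeasure P h B < ∞) :
    Tendsto (fun n : ℕ => towerMeasure P h ((towerMap σ h)^[n] '' A ∩ B)) atTop (𝓝 0) := by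
  let tail (K : ℕ) : Set (Ω × ℕ) := {x | x ∈ towerSet h → K ≤ x.2}
  have htail_meas : ∀ K, MeasurableSet (tail K) := fun K =>
    (measurableSet_towerSet hh).imp (measurableSet_le measurable_const measurable_snd)
  have htail : ∀ C : Set (Ω × ℕ), MeasurableSet C → towerMeasure P h C < ∞ →
      Tendsto (fun K => towerMeasure P h (C ∩ tail K)) atTop (𝓝 0) := by
    intro C hC hCfin
    have := tendsto_measure_iInter_atTop (μ := towerMeasure P h) (s := fun K => C ∩ tail K)
      (fun K => (hC.inter (htail_meas K)).nullMeasurableSet)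
      (fun K L hKL x hx => ⟨hx.1, fun ht => hKL.trans (hx.2 ht)⟩)
      ⟨0, ((measure_mono inter_subset_left).trans_lt hCfin).ne⟩
    rwa [measure_mono_null ?_ (towerMeasure_compl_towerSet (P := P) hh)] at this
    intro x hx ht
    exact absurd ((mem_iInter.1 hx (x.2 + 1)).2 ht) (by omega)
  have hlevel : ∀ K, Tendsto (fun n : ℕ => ∑ i ∈ Finset.range K, ∑ j ∈ Finset.range K,
      towerMeasure P h ((towerMap σ h)^[n] '' (towerSet h ∩ {x | x.2 = i}) ∩
        (towerSet h ∩ {x | x.2 = j}))) atTop (𝓝 0) := by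
    intro K
    rw [← show ∑ i ∈ Finset.range K, ∑ j ∈ Finset.range K, (0 : ℝ≥0∞) = 0 by simp]
    refine tendsto_finsetSum _ fun i _ => tendsto_finsetSum _ fun j _ => ?_
    have hlim : Tendsto (fun n : ℕ => n + i - j) atTop atTop :=
      (tendsto_sub_atTop_nat j).comp (tendsto_add_atTop_nat i)
    refine tendsto_of_tendsto_of_tendsto_of_le_of_le' tendsto_const_nhds (hzero.comp hlim)
      (Eventually.of_forall fun _ => zero_le) ?_
    filter_upwards [eventually_ge_atTop j] with n hn
    exact towerMeasure_image_level_inter_le hσ hh hpos hn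
  have hbound : ∀ K n : ℕ, towerMeasure P h ((towerMap σ h)^[n] '' A ∩ B) ≤
      (towerMeasure P h (A ∩ tail K) + towerMeasure P h (B ∩ tail K)) +
      ∑ i ∈ Finset.range K, ∑ j ∈ Finset.range K,
        towerMeasure P h ((towerMap σ h)^[n] '' (towerSet h ∩ {x | x.2 = i}) ∩
          (towerSet h ∩ {x | x.2 = j})) := by
    intro K n
    have hsub : (towerMap σ h)^[n] '' A ∩ B ⊆ ((towerMap σ h)^[n] '' (A ∩ tail K) ∪ B ∩ tail K) ∪
        ⋃ i ∈ Finset.range K, ⋃ j ∈ Finset.range K,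
          (towerMap σ h)^[n] '' (towerSet h ∩ {x | x.2 = i}) ∩ (towerSet h ∩ {x | x.2 = j}) := by
      rintro _ ⟨⟨x, hx, rfl⟩, hy⟩
      by_cases hxt : x ∈ tail K
      · exact Or.inl (Or.inl ⟨x, ⟨hx, hxt⟩, rfl⟩)
      by_cases hyt : (towerMap σ h)^[n] x ∈ tail K
      · exact Or.inl (Or.inr ⟨hy, hyt⟩)
      simp only [tail, mem_ofPred_eq, Classical.not_imp, not_le] at hxt hyt
      refine Or.inr ?_
      simp only [mem_iUnion, Finset.mem_range]
      exact ⟨x.2, hxt.2, _, hyt.2, ⟨x, ⟨hxt.1, rfl⟩, rfl⟩, hyt.1, rfl⟩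
    refine (measure_mono hsub).trans ((measure_union_le _ _).trans (add_le_add ?_ ?_))
    · refine (measure_union_le _ _).trans_eq ?_
      rw [towerMeasure_image_iterate hσ hh hpos]
    · exact (measure_biUnion_finset_le _ _).trans
        (Finset.sum_le_sum fun i _ => measure_biUnion_finset_le _ _)
  rw [ENNReal.tendsto_nhds_zero]
  intro ε hε
  have htails := (htail A hA hAfin).add (htail B hB hBfin)
  rw [add_zero, ENNReal.tendsto_nhds_zero] at htails
  obtain ⟨K, hK⟩ := (htails (ε / 2) (ENNReal.half_pos hε.ne')).exists
  filter_upwards [ENNReal.tendsto_nhds_zero.1 (hlevel K) (ε / 2) (ENNReal.half_pos hε.ne')]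
    with n hn
  exact (hbound K n).trans ((add_le_add hK hn).trans_eq (ENNReal.add_halves ε))

end Measure

end Tower

theorem towerMap_snd_even_iff {Ω : Type*} [MeasurableSpace Ω] {σ : Ω ≃ᵐ Ω} {h : Ω → ℕ}
    (heven : ∀ ω, Even (h ω)) {x : Ω × ℕ} (hx : x ∈ towerSet h) :
    Even (towerMap σ h x).2 ↔ ¬ Even x.2 := by
  obtain ⟨ω, j⟩ := x
  rcases (Nat.succ_le_of_lt hx).lt_or_eq with hj | hj
  · rw [towerMap_of_lt hj, Nat.even_add_one]
  · have := heven ω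
    rw [← hj, Nat.succ_eq_add_one, Nat.even_add_one] at this
    simpa [towerMap_of_eq hj] using this

theorem measure_le_towerMeasure_level {Ω : Type*} [MeasurableSpace Ω] {P : Measure Ω} [SFinite P]
    {h : Ω → ℕ} (hh : Measurable h) {k : ℕ} (hk : ∀ ω, k < h ω) :
    P univ ≤ towerMeasure P h (towerSet h ∩ {x | x.2 = k}) := by
  rw [towerMeasure_apply hh ((measurableSet_towerSet hh).inter
    (measurableSet_eq_fun measurable_snd measurable_const))]
  refine le_trans (measure_mono fun ω _ => ?_) (ENNReal.le_tsum k)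
  exact ⟨hk ω, hk ω, rfl⟩

section Renewal

theorem infinitePi_inter_eq_mul_of_dependsOn {ι α : Type*} [MeasurableSpace α] [Countable α]
    [MeasurableSingletonClass α] (p : ι → Measure α) [∀ i, IsProbabilityMeasure (p i)]
    {s t : Finset ι} (hst : Disjoint s t) {A B : Set (ι → α)} (hA : DependsOn (· ∈ A) (s : Set ι))
    (hB : DependsOn (· ∈ B) (t : Set ι)) :
    Measure.infinitePi p (A ∩ B) = Measure.infinitePi p A * Measure.infinitePi p B := by
  have hcyl : ∀ (u : Finset ι) (C : Set (ι → α)), DependsOn (· ∈ C) (u : Set ι) →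
      C = cylinder u (u.restrict '' C) := by
    intro u C hC
    refine (subset_preimage_image _ _).antisymm ?_
    rintro ω ⟨ω', hω', heq⟩
    exact (hC fun i hi => congrFun heq ⟨i, hi⟩).mp hω'
  rw [hcyl s A hA, hcyl t B hB]
  exact infinitePi_inter_cylinder p hst (to_countable _).measurableSet (to_countable _).measurableSet

theorem nullSingletonClass_infinitePi {ι α : Type*} [Infinite ι] [MeasurableSpace α]
    [MeasurableSingletonClass α] (p : Measure α) [IsProbabilityMeasure p] {c : ℝ≥0∞} (hc : c < 1)
    (hp : ∀ a, p {a} ≤ c) : NullSingletonClass (Measure.infinitePi fun _ : ι => p) := by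
  refine ⟨fun ω => le_antisymm (ge_of_tendsto' (ENNReal.tendsto_pow_atTop_nhds_zero_of_lt_one hc)
    fun n => ?_) zero_le⟩
  obtain ⟨s, hs⟩ := Infinite.exists_subset_card_eq ι n
  calc Measure.infinitePi (fun _ => p) {ω}
      ≤ Measure.infinitePi (fun _ => p) ((s : Set ι).pi fun i => {ω i}) :=
        measure_mono (by rintro _ rfl i _; rfl)
    _ = ∏ i ∈ s, p {ω i} := Measure.infinitePi_pi _ fun i _ => measurableSet_singleton _
    _ ≤ c ^ n := by
        rw [← hs]
        exact Finset.prod_le_pow_card s _ c fun i _ => hp (ω i)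

variable {g : ℕ → ℕ}

theorem dependsOn_towerMap_iterate (hg : ∀ k, 0 < g k) (n : ℕ) :
    DependsOn (· ∈ {ω : ℤ → ℕ |
      ((towerMap (shiftEquiv ℕ) fun ω => g (ω 0))^[n] (ω, 0)).2 = 0}) (Ico (0 : ℤ) n) := by
  induction n using Nat.strong_induction_on with
  | _ n ih =>
    intro ω ω' hω
    cases n with
    | zero => simp
    | succ n =>
      simp only [mem_ofPred_eq, towerMap_iterate_succ_snd_eq_zero_iff (fun ω : ℤ → ℕ => hg (ω 0))]
      rw [hω 0 (by simp)]
      refine propext (exists_congr fun j => and_congr_right fun hj => and_congr_right fun _ => ?_)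
      refine iff_of_eq (ih (n - j) (by omega) fun i hi => ?_)
      simp only [mem_Ico] at hi
      exact hω (i + 1) (by simp; omega)

variable (p : Measure ℕ) [IsProbabilityMeasure p]

theorem measureReal_return_succ (hg : ∀ k, 0 < g k) (n : ℕ) :
    (Measure.infinitePi fun _ : ℤ => p).real {ω : ℤ → ℕ |
        ((towerMap (shiftEquiv ℕ) fun ω => g (ω 0))^[n + 1] (ω, 0)).2 = 0} =
      ∑ j ∈ Finset.range (n + 1),
        (Measure.infinitePi fun _ : ℤ => p).real {ω | g (ω 0) = j + 1} *
        (Measure.infinitePi fun _ : ℤ => p).real {ω : ℤ → ℕ |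
          ((towerMap (shiftEquiv ℕ) fun ω => g (ω 0))^[n - j] (ω, 0)).2 = 0} := by
  set P := Measure.infinitePi fun _ : ℤ => p with hP
  have hh : Measurable fun ω : ℤ → ℕ => g (ω 0) := by fun_prop
  let R (m : ℕ) : Set (ℤ → ℕ) := {ω | ((towerMap (shiftEquiv ℕ) fun ω => g (ω 0))^[m] (ω, 0)).2 = 0}
  have hR : ∀ m, MeasurableSet (R m) := fun m =>
    measurableSet_eq_fun (measurable_snd.comp
      (((measurable_towerMap hh).iterate m).comp measurable_prodMk_right)) measurable_const
  have hH : ∀ j, MeasurableSet {ω : ℤ → ℕ | g (ω 0) = j + 1} := fun j =>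
    measurableSet_eq_fun hh measurable_const
  have hunion : R (n + 1) = ⋃ j ∈ Finset.range (n + 1),
      {ω | g (ω 0) = j + 1} ∩ shiftEquiv ℕ ⁻¹' R (n - j) := by
    ext ω
    simp only [R, mem_ofPred_eq, towerMap_iterate_succ_snd_eq_zero_iff (fun ω : ℤ → ℕ => hg (ω 0)),
      mem_iUnion, exists_prop, mem_inter_iff, mem_preimage]
  have hind : ∀ j, P ({ω | g (ω 0) = j + 1} ∩ shiftEquiv ℕ ⁻¹' R (n - j)) =
      P {ω | g (ω 0) = j + 1} * P (R (n - j)) := by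
    intro j
    rw [← (measurePreserving_shiftEquiv p).measure_preimage (hR (n - j)).nullMeasurableSet]
    refine infinitePi_inter_eq_mul_of_dependsOn (fun _ : ℤ => p) (s := {0})
      (t := Finset.Ico 1 ((n - j : ℕ) + 1)) (by simp) (fun ω ω' hω => ?_) fun ω ω' hω => ?_
    · simp [hω 0 (by simp)]
    · refine dependsOn_towerMap_iterate hg (n - j) fun i hi => hω (i + 1) ?_
      simp only [mem_Ico, Finset.coe_Ico] at hi ⊢
      omega
  change P.real (R (n + 1)) = _
  rw [hunion, measureReal_biUnion_finset]
  · refine Finset.sum_congr rfl fun j _ => ?_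
    rw [measureReal_def, hind, ENNReal.toReal_mul]
    rfl
  · intro i _ j _ hij
    refine disjoint_left.2 fun ω h1 h2 => hij ?_
    have := h1.1.symm.trans h2.1
    omega
  · exact fun j _ => (hH j).inter ((shiftEquiv ℕ).measurable (hR _))

theorem tendsto_measure_return (hg : ∀ k, 0 < g k) (hg2 : p {k | g k = 2} ≠ 0)
    (hint : ∫⁻ k, (g k : ℝ≥0∞) ∂p = ∞) :
    Tendsto (fun n => (Measure.infinitePi fun _ : ℤ => p) {ω : ℤ → ℕ |
      ((towerMap (shiftEquiv ℕ) fun ω => g (ω 0))^[n] (ω, 0)).2 = 0}) atTop (𝓝 0) := by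
  set P := Measure.infinitePi fun _ : ℤ => p with hP
  have hh : Measurable fun ω : ℤ → ℕ => g (ω 0) := by fun_prop
  let F (j : ℕ) : ℝ := P.real {ω | j < g (ω 0)}
  have hanti : Antitone F := fun i j hij => measureReal_mono fun ω hω => hij.trans_lt hω
  have hdiff : ∀ j, F j - F (j + 1) = P.real {ω | g (ω 0) = j + 1} := by
    intro j
    have hsub : {ω : ℤ → ℕ | j + 1 < g (ω 0)} ⊆ {ω | j < g (ω 0)} :=
      fun ω hω => (Nat.lt_succ_self j).trans hω
    change P.real _ - P.real _ = _
    rw [← measureReal_sdiff hsub (measurableSet_lt measurable_const hh)]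
    congr 1
    ext ω
    simp only [Set.mem_sdiff, mem_ofPred_eq]
    omega
  have htop : ∑' j, ENNReal.ofReal (F j) = ∞ := by
    have h1 := towerMeasure_univ (P := P) hh
    rw [(measurePreserving_eval_infinitePi (fun _ : ℤ => p) 0).lintegral_comp
      (f := fun k => (g k : ℝ≥0∞)) (by fun_prop), hint, towerMeasure_apply hh .univ] at h1
    simpa [F, ofReal_measureReal] using h1
  have hdiv : ¬ Summable fun i => F ((1 + 1) * i) := by
    intro hs
    refine Summable.tsum_ofReal_ne_top (Summable.even_add_odd hs ?_) htop
    exact hs.of_nonneg_of_le (fun _ => measureReal_nonneg) fun i => hanti (Nat.le_succ _)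
  have hlim : Tendsto (fun n => P.real {ω : ℤ → ℕ |
      ((towerMap (shiftEquiv ℕ) fun ω => g (ω 0))^[n] (ω, 0)).2 = 0}) atTop (𝓝 0) := by
    refine tendsto_zero_of_renewal (F := F) (d := 1) hanti ?_ (fun _ => measureReal_nonneg) ?_ ?_
      ?_ hdiv
    · simp [F, hg]
    · simp
    · intro n
      simp_rw [hdiff]
      exact measureReal_return_succ p hg n
    · rw [← sub_pos, hdiff]
      refine ENNReal.toReal_pos ?_ (measure_ne_top _ _)
      rwa [← (measurePreserving_eval_infinitePi (fun _ : ℤ => p) 0).measure_preimage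
        (MeasurableSet.of_discrete).nullMeasurableSet] at hg2
  simpa [ofReal_measureReal] using ENNReal.tendsto_ofReal hlim

end Renewal

/-- The law on `ℕ` which gives mass `2⁻¹ ^ (k + 1)` to `k`. -/
noncomputable def dyadicLaw : Measure ℕ :=
  Measure.sum fun k => (2⁻¹ : ℝ≥0∞) ^ (k + 1) • Measure.dirac k

theorem lintegral_dyadicLaw (f : ℕ → ℝ≥0∞) :
    ∫⁻ k, f k ∂dyadicLaw = ∑' k, 2⁻¹ ^ (k + 1) * f k := by
  simp [dyadicLaw, lintegral_sum_measure]

theorem dyadicLaw_singleton (k : ℕ) : dyadicLaw {k} = 2⁻¹ ^ (k + 1) := by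
  rw [← lintegral_indicator_one (measurableSet_singleton k), lintegral_dyadicLaw,
    tsum_eq_single k (by simp +contextual)]
  simp

instance : IsProbabilityMeasure dyadicLaw := by
  refine ⟨?_⟩
  rw [← lintegral_one, lintegral_dyadicLaw]
  simp only [mul_one]
  rw [ENNReal.tsum_geometric_add_one]
  simp [ENNReal.one_sub_inv_two, ENNReal.inv_mul_cancel]

theorem lintegral_two_pow_dyadicLaw :
    ∫⁻ k, ((2 ^ (k + 1) : ℕ) : ℝ≥0∞) ∂dyadicLaw = ∞ := by
  rw [lintegral_dyadicLaw]
  have : ∀ k : ℕ, (2⁻¹ : ℝ≥0∞) ^ (k + 1) * ((2 ^ (k + 1) : ℕ) : ℝ≥0∞) = 1 := fun k => by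
    rw [Nat.cast_pow, Nat.cast_ofNat, ← mul_pow, ENNReal.inv_mul_cancel (by simp) (by simp), one_pow]
  simp only [this]
  exact ENNReal.tsum_const_eq_top_of_ne_zero one_ne_zero

/-- The uniform measure on `Bool`. -/
noncomputable def coinMeasure : Measure Bool :=
  (2⁻¹ : ℝ≥0∞) • Measure.dirac true + (2⁻¹ : ℝ≥0∞) • Measure.dirac false

theorem coinMeasure_singleton_ne_zero (b : Bool) : coinMeasure {b} ≠ 0 := by
  cases b <;> simp [coinMeasure]

instance : IsProbabilityMeasure coinMeasure :=
  ⟨by simp [coinMeasure, ENNReal.inv_two_add_inv_two]⟩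

theorem measurePreserving_not_coinMeasure : MeasurePreserving not coinMeasure coinMeasure := by
  refine ⟨.of_discrete, ?_⟩
  rw [coinMeasure, Measure.map_add _ _ .of_discrete, Measure.map_smul, Measure.map_smul,
    Measure.map_dirac' .of_discrete, Measure.map_dirac' .of_discrete, add_comm]
  rfl

theorem isErgodicT_not_coinMeasure : IsErgodicT coinMeasure not := by
  intro A _ hA
  have h1 : false ∈ A ↔ true ∈ A := by simpa using Set.ext_iff.1 hA true
  by_cases h2 : true ∈ A
  · have : Aᶜ = ∅ := by
      ext b
      cases b <;> simp [h1, h2]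
    exact Or.inr (by rw [this, measure_empty])
  · have : A = ∅ := by
      ext b
      cases b <;> simp [h1, h2]
    exact Or.inl (by rw [this, measure_empty])

theorem not_isErgodicT_prod_towerMap {Ω : Type*} [MeasurableSpace Ω] {P : Measure Ω} [SFinite P]
    [NeZero P] {σ : Ω ≃ᵐ Ω} {h : Ω → ℕ} (hh : Measurable h) (hpos : ∀ ω, 0 < h ω)
    (heven : ∀ ω, Even (h ω)) :
    ¬ IsErgodicT ((towerMeasure P h).prod coinMeasure) (Prod.map (towerMap σ h) not) := by
  intro hT
  let W : Set ((Ω × ℕ) × Bool) := {y | y.1 ∈ towerSet h ∧ (Even y.1.2 ↔ y.2 = true)}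
  have hW : MeasurableSet W := by
    refine (measurable_fst (measurableSet_towerSet hh)).inter ?_
    exact (measurable_snd.comp measurable_fst (MeasurableSet.of_discrete (s := {n | Even n}))).iff
      (measurable_snd (measurableSet_singleton true))
  have hinv : Prod.map (towerMap σ h) not ⁻¹' W = W := by
    ext ⟨x, b⟩
    simp only [W, mem_preimage, Prod.map_apply, mem_ofPred_eq, towerMap_mem_towerSet_iff hpos]
    refine and_congr_right fun hx => ?_
    rw [towerMap_snd_even_iff heven hx]
    cases b <;> simp
  have hne : ∀ b, ((towerMeasure P h).prod coinMeasure)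
      ((towerSet h ∩ {x | x.2 = 0}) ×ˢ {b}) ≠ 0 := by
    intro b
    rw [Measure.prod_prod]
    refine mul_ne_zero (fun h0 => ?_) (coinMeasure_singleton_ne_zero b)
    exact NeZero.ne P (Measure.measure_univ_eq_zero.1
      (le_antisymm ((measure_le_towerMeasure_level hh hpos).trans_eq h0) zero_le))
  rcases hT W hW hinv with h0 | h0
  · refine hne true (measure_mono_null ?_ h0)
    rintro ⟨x, b⟩ ⟨⟨hx, hx'⟩, hb⟩
    exact ⟨hx, by simp_all⟩
  · refine hne false (measure_mono_null ?_ h0)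
    rintro ⟨x, b⟩ ⟨⟨hx, hx'⟩, hb⟩ hxW
    simp_all [W]

/-- There is an invertible measure-preserving conservative ergodic transformation `T` of
an infinite nonatomic σ-finite measure space which is Koopman mixing and has a set `E` of
positive, non-full measure with `T⁻¹(E) = X ∖ E` up to a null set; in particular `T` is
not weakly mixing. -/
theorem exists_koopmanMixing_not_weakMixing :
    ∃ (X : Type) (_ : MeasurableSpace X) (μ : Measure X) (_ : SigmaFinite μ)
      (T : X ≃ᵐ X) (E : Set X),
      (∀ x : X, μ {x} = 0) ∧ μ Set.univ = ∞ ∧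
      MeasurePreserving T μ μ ∧
      IsConservative μ T ∧ IsErgodicT μ T ∧
      (∀ A B : Set X, MeasurableSet A → MeasurableSet B → μ A < ∞ → μ B < ∞ →
        Filter.Tendsto (fun n : ℕ => μ ((⇑T)^[n] '' A ∩ B)) Filter.atTop (nhds 0)) ∧
      MeasurableSet E ∧ 0 < μ E ∧ 0 < μ Eᶜ ∧
      μ ((⇑T ⁻¹' E) ∆ Eᶜ) = 0 ∧
      ¬ (∀ (Y : Type) (_ : MeasurableSpace Y) (ν : Measure Y) (S : Y → Y),
          IsProbabilityMeasure ν → MeasurePreserving S ν ν → IsErgodicT ν S →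
          IsErgodicT (μ.prod ν) (Prod.map (⇑T) S)) := by
  let h : (ℤ → ℕ) → ℕ := fun ω => 2 ^ (ω 0 + 1)
  let P : Measure (ℤ → ℕ) := Measure.infinitePi fun _ => dyadicLaw
  have hh : Measurable h := by fun_prop
  have hpos : ∀ ω, 0 < h ω := fun ω => by positivity
  have heven : ∀ ω, Even (h ω) := fun ω => (even_two).pow_of_ne_zero (Nat.succ_ne_zero _)
  have hone : ∀ ω, 1 < h ω := fun ω => Nat.one_lt_two_pow (Nat.succ_ne_zero _)
  have hσ : Ergodic (shiftEquiv ℕ) P := ergodic_shiftEquiv dyadicLaw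
  have : NullSingletonClass P := nullSingletonClass_infinitePi dyadicLaw
    ENNReal.one_half_lt_one fun k => by
      rw [dyadicLaw_singleton]
      exact pow_le_of_le_one zero_le (by simp) (Nat.succ_ne_zero k)
  have hzero := tendsto_measure_return (g := fun k => 2 ^ (k + 1)) dyadicLaw
    (fun k => by positivity)
    (fun h0 => by
      have := measure_mono_null (singleton_subset_iff.2 (show 0 ∈ {k : ℕ | 2 ^ (k + 1) = 2} by simp)) h0
      simp [dyadicLaw_singleton] at this)
    lintegral_two_pow_dyadicLaw
  have hlevel : ∀ k, (∀ ω, k < h ω) → 0 < towerMeasure P h (towerSet h ∩ {x | x.2 = k}) :=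
    fun k hk => lt_of_lt_of_le (by simp [P]) (measure_le_towerMeasure_level (P := P) hh hk)
  refine ⟨(ℤ → ℕ) × ℕ, inferInstance, towerMeasure P h,
    inferInstanceAs (SigmaFinite ((P.prod Measure.count).restrict (towerSet h))),
    towerEquiv (shiftEquiv ℕ) hh hpos, {x | Even x.2}, towerMeasure_singleton, ?_,
    measurePreserving_towerMap hσ.toMeasurePreserving hh hpos,
    isConservative_towerMap hσ.toMeasurePreserving hh hpos, isErgodicT_towerMap hσ hh hpos,
    fun A B hA hB hAfin hBfin => tendsto_towerMeasure_image_iterate_inter hσ.toMeasurePreserving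
      hh hpos hzero hA hB hAfin hBfin,
    measurable_snd (MeasurableSet.of_discrete (s := {n | Even n})), ?_, ?_, ?_, fun hwm => ?_⟩
  · rw [towerMeasure_univ hh, ← lintegral_two_pow_dyadicLaw]
    exact (measurePreserving_eval_infinitePi (fun _ : ℤ => dyadicLaw) 0).lintegral_comp
      (f := fun k => ((2 ^ (k + 1) : ℕ) : ℝ≥0∞)) .of_discrete
  · refine (hlevel 0 hpos).trans_le (measure_mono fun x hx => ?_)
    simp [show x.2 = 0 from hx.2]
  · refine (hlevel 1 hone).trans_le (measure_mono fun x hx => ?_)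
    simp [show x.2 = 1 from hx.2]
  · refine measure_mono_null (t := (towerSet h)ᶜ) (fun x hx hxt => ?_)
      (towerMeasure_compl_towerSet (P := P) hh)
    have := towerMap_snd_even_iff (σ := shiftEquiv ℕ) heven hxt
    change Even (towerMap (shiftEquiv ℕ) h x).2 ∧ ¬ ¬ Even x.2 ∨
      ¬ Even x.2 ∧ ¬ Even (towerMap (shiftEquiv ℕ) h x).2 at hx
    tauto
  · exact not_isErgodicT_prod_towerMap (P := P) hh hpos heven
      (hwm Bool _ coinMeasure not inferInstance measurePreserving_not_coinMeasure
        isErgodicT_not_coinMeasure)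
end
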